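/- Let m : ℕ → ℕ and set λ(n) := (2·m(n) − n)·n^{−2/3}. Suppose λ(n) → ∞ and λ(n)/n^{1/3} → 0 as n → ∞. If l₀ : ℕ → ℝ is such that for every sufficiently large n, l₀(n) solves the excess equation for (n, m(n)), then there exist constants c₁, c₂ > 0 such that for all sufficiently large n: c₁·λ(n) ≤ l₀(n) ≤ c₂·λ(n). -/

import Mathlib

open Filter

/-- The constant γ = 79^(3/4)/54^(1/2). -/
noncomputable def gammaK : ℝ := (79 : ℝ) ^ ((3 : ℝ) / 4) / (54 : ℝ) ^ ((1 : ℝ) / 2)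

/-- The constant φ = 2·√e·γ²·3^(−3/2). -/
noncomputable def phiC : ℝ := 2 * Real.sqrt (Real.exp 1) * gammaK ^ 2 * (3 : ℝ) ^ (-(3 : ℝ) / 2)

/-- `l₀` solves the excess equation for `(n, m)`: it lies strictly between
`max 0 (m − n)` and `m − n/2` and satisfies
`l₀ · e^(1/3) · 2^(4/3) · (n − m + l₀)^(2/3) = φ^(2/3) · (2m − n − 2l₀)`. -/
def SolvesExcessEq (n m l₀ : ℝ) : Prop :=
  max 0 (m - n) < l₀ ∧ l₀ < m - n / 2 ∧
    l₀ * Real.exp 1 ^ ((1 : ℝ) / 3) * (2 : ℝ) ^ ((4 : ℝ) / 3) * (n - m + l₀) ^ ((2 : ℝ) / 3)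
      = phiC ^ ((2 : ℝ) / 3) * (2 * m - n - 2 * l₀)

theorem stmt5 (m : ℕ → ℕ) (l₀ : ℕ → ℝ)
    (hlam : Tendsto (fun n : ℕ => ((2 * m n : ℝ) - n) * (n : ℝ) ^ (-(2 : ℝ) / 3)) atTop atTop)
    (hlam' : Tendsto
      (fun n : ℕ => (((2 * m n : ℝ) - n) * (n : ℝ) ^ (-(2 : ℝ) / 3)) / (n : ℝ) ^ ((1 : ℝ) / 3))
      atTop (nhds 0))
    (hl : ∀ᶠ n : ℕ in atTop, SolvesExcessEq n (m n) (l₀ n)) :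
    ∃ c₁ c₂ : ℝ, 0 < c₁ ∧ 0 < c₂ ∧ ∀ᶠ n : ℕ in atTop,
      c₁ * (((2 * m n : ℝ) - n) * (n : ℝ) ^ (-(2 : ℝ) / 3)) ≤ l₀ n ∧
      l₀ n ≤ c₂ * (((2 * m n : ℝ) - n) * (n : ℝ) ^ (-(2 : ℝ) / 3)) := by
  have hphi : 0 < phiC := by unfold phiC gammaK; positivity
  obtain ⟨P, hPdef⟩ : ∃ P, P = phiC ^ ((2 : ℝ) / 3) := ⟨_, rfl⟩
  have hP : 0 < P := by rw [hPdef]; positivity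
  obtain ⟨A, hAdef⟩ : ∃ A, A = Real.exp 1 ^ ((1 : ℝ) / 3) * (2 : ℝ) ^ ((4 : ℝ) / 3) := ⟨_, rfl⟩
  have hA : 0 < A := by rw [hAdef]; positivity
  obtain ⟨q, hqdef⟩ : ∃ q, q = ((1 : ℝ) / 4) ^ ((2 : ℝ) / 3) := ⟨_, rfl⟩
  have hq : 0 < q := by rw [hqdef]; positivity
  refine ⟨P / (A + 2 * P), P / (A * q), by positivity, by positivity, ?_⟩
  filter_upwards [hl, hlam'.eventually (gt_mem_nhds (by norm_num : (0 : ℝ) < 1 / 2)),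
    eventually_ge_atTop 1] with n hn hsmall hn1
  obtain ⟨h1, h2, h3⟩ := hn
  have hl0 : 0 < l₀ n := lt_of_le_of_lt (le_max_left _ _) h1
  have hnR : (1 : ℝ) ≤ n := by exact_mod_cast hn1
  have hn0 : (0 : ℝ) < n := by linarith
  have hneg : (n : ℝ) ^ (-(2 : ℝ) / 3) = ((n : ℝ) ^ ((2 : ℝ) / 3))⁻¹ := by
    rw [neg_div, Real.rpow_neg hn0.le]
  have hprod : (n : ℝ) ^ ((2 : ℝ) / 3) * (n : ℝ) ^ ((1 : ℝ) / 3) = n := by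
    rw [← Real.rpow_add hn0]; norm_num
  have hN1 : 1 ≤ (n : ℝ) ^ ((2 : ℝ) / 3) := Real.one_le_rpow hnR (by norm_num)
  rw [hneg, ← div_eq_mul_inv, div_div, hprod, div_lt_iff₀ hn0] at hsmall
  have hK1 : q * (n : ℝ) ^ ((2 : ℝ) / 3) ≤ ((n : ℝ) - m n + l₀ n) ^ ((2 : ℝ) / 3) := by
    rw [hqdef, ← Real.mul_rpow (by norm_num) hn0.le]
    exact Real.rpow_le_rpow (by positivity) (by linarith) (by norm_num)
  have hK2 : ((n : ℝ) - m n + l₀ n) ^ ((2 : ℝ) / 3) ≤ (n : ℝ) ^ ((2 : ℝ) / 3) :=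
    Real.rpow_le_rpow (by linarith) (by linarith) (by norm_num)
  rw [hneg]
  rw [mul_assoc (l₀ n), ← hAdef, ← hPdef] at h3
  generalize ((n : ℝ) - m n + l₀ n) ^ ((2 : ℝ) / 3) = K at *
  generalize (n : ℝ) ^ ((2 : ℝ) / 3) = N at *
  have hN : 0 < N := by linarith
  rw [← div_eq_mul_inv, div_mul_div_comm, div_mul_div_comm, div_le_iff₀ (by positivity),
    le_div_iff₀ (by positivity)]
  have e1 : l₀ n * A * (q * N) ≤ l₀ n * A * K := by gcongr
  have e2 : l₀ n * A * K ≤ l₀ n * A * N := by gcongr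
  have e3 : l₀ n * P * 1 ≤ l₀ n * P * N := by gcongr
  have e4 : 0 < l₀ n * P := by positivity
  constructor <;> nlinarith
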